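/- Lower bound on the marginals of the conditioned tensorized data (Lemma 12.4). Let d ≥ 2, ℓ > 0, N ∈ ℕ, and let ε > 0 satisfy the Boltzmann–Grad scaling N ε^{d−1} = ℓ^{−1}. Let f_0 be a probability density on ℝ^d × ℝ^d with M := ‖f_0‖_{L^∞_x L^1_v} < ∞, and assume ℓ^{−1} |B_1^d| M ε < 1. Then for every 1 ≤ s ≤ N and (almost) every Z_s ∈ ℝ^{2ds}: f_N^{(s)}(0,Z_s) ≥ 1_{Z_s ∈ D_s} · ∏_{i=1}^s f_0(x_i,v_i) · ( 1 − (s+1) ℓ^{−1} |B_1^d| M ε ), where |B_1^d| is the Lebesgue measure of the unit ball in ℝ^d. -/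

import Mathlib

noncomputable section
open MeasureTheory
open scoped BigOperators

/-- Euclidean space `ℝ^d`. -/
abbrev Rd (d : ℕ) := EuclideanSpace ℝ (Fin d)

/-- The `s`-particle hard-sphere phase space `D_s`: all pairwise distances exceed `ε`. -/
def Dset (d s : ℕ) (ε : ℝ) : Set (Fin s → Rd d × Rd d) :=
  {Z | ∀ i j : Fin s, i < j → ε < dist (Z i).1 (Z j).1}

/-- The partition function `𝒵_s = ∫ 1_{Z_s ∈ D_s} ∏ f₀(z_i) dZ_s`. -/
def partitionFunction (d s : ℕ) (ε : ℝ) (f₀ : Rd d × Rd d → ℝ) : ℝ :=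
  ∫ Z in Dset d s ε, ∏ i, f₀ (Z i)

/-- The volume of the unit ball in `ℝ^d`. -/
def unitBallVol (d : ℕ) : ℝ := (volume (Metric.ball (0 : Rd d) 1)).toReal

/-- The conditioned tensorized `N`-particle density
`f_N(0,Z_N) = 𝒵_N⁻¹ 1_{Z_N ∈ D_N} ∏ f₀(z_i)`. -/
def conditionedData (d N : ℕ) (ε : ℝ) (f₀ : Rd d × Rd d → ℝ)
    (Z : Fin N → Rd d × Rd d) : ℝ :=
  (partitionFunction d N ε f₀)⁻¹ *
    Set.indicator (Dset d N ε) (fun W => ∏ i, f₀ (W i)) Z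

/-- The `s`-particle marginal of an `N`-particle function. -/
def marginal (d N s : ℕ) (hsN : s ≤ N) (F : (Fin N → Rd d × Rd d) → ℝ)
    (Z : Fin s → Rd d × Rd d) : ℝ :=
  ∫ W : Fin (N - s) → Rd d × Rd d,
    F (Fin.append Z W ∘ Fin.cast (Nat.add_sub_cancel' hsN).symm)

/-- A finite product of a measure with an integrable nonnegative density has the tensorized
density. -/
lemma pi_withDensity_ofReal {ι α : Type*} [Fintype ι] [MeasurableSpace α] (ν : Measure α)
    [SigmaFinite ν] {f : α → ℝ} (hnn : ∀ z, 0 ≤ f z) (hint : Integrable f ν) :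
    Measure.pi (fun _ : ι => ν.withDensity fun z => ENNReal.ofReal (f z)) =
      (Measure.pi fun _ : ι => ν).withDensity fun Z => ENNReal.ofReal (∏ i, f (Z i)) := by
  refine Measure.pi_eq fun s hs => ?_
  rw [withDensity_apply _ (MeasurableSet.univ_pi hs), Measure.restrict_pi_pi,
    ← ofReal_integral_eq_lintegral_ofReal
      (Integrable.fintype_prod fun i => hint.restrict)
      (Filter.Eventually.of_forall fun Z => Finset.prod_nonneg fun i _ => hnn _),
    integral_fintype_prod_eq_prod (f := fun _ => f),
    ENNReal.ofReal_prod_of_nonneg fun i _ => integral_nonneg hnn]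
  refine Finset.prod_congr rfl fun i _ => ?_
  rw [withDensity_apply _ (hs i), ofReal_integral_eq_lintegral_ofReal hint.restrict
    (Filter.Eventually.of_forall hnn)]

lemma setIntegral_prod_eq_pi_withDensity {ι α : Type*} [Fintype ι] [MeasureSpace α]
    [SigmaFinite (volume : Measure α)] {f : α → ℝ} (hnn : ∀ z, 0 ≤ f z) (hint : Integrable f)
    {A : Set (ι → α)} (hA : MeasurableSet A) :
    ∫ Z in A, ∏ i, f (Z i) =
      (Measure.pi fun _ : ι => volume.withDensity fun z => ENNReal.ofReal (f z)).real A := by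
  rw [pi_withDensity_ofReal volume hnn hint, measureReal_def, withDensity_apply _ hA,
    ← ofReal_integral_eq_lintegral_ofReal, ENNReal.toReal_ofReal]
  · rfl
  · exact integral_nonneg fun Z => Finset.prod_nonneg fun i _ => hnn _
  · exact (Integrable.fintype_prod fun i => hint).restrict
  · exact Filter.Eventually.of_forall fun Z => Finset.prod_nonneg fun i _ => hnn _

lemma measurableSet_Dset (d s : ℕ) (ε : ℝ) : MeasurableSet (Dset d s ε) := by
  simp only [Dset, Set.ofPred_forall]
  refine MeasurableSet.iInter fun i => MeasurableSet.iInter fun j => MeasurableSet.iInter fun _ =>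
    measurableSet_lt (by fun_prop) (by fun_prop)

/-- Membership in `Dset` does not depend on the order of the particles. -/
lemma mem_Dset_iff_ne {d s : ℕ} {ε : ℝ} {Z : Fin s → Rd d × Rd d} :
    Z ∈ Dset d s ε ↔ ∀ i j : Fin s, i ≠ j → ε < dist (Z i).1 (Z j).1 := by
  refine ⟨fun h i j hij => ?_, fun h i j hij => h i j hij.ne⟩
  rcases lt_or_gt_of_ne hij with h' | h'
  · exact h i j h'
  · rw [dist_comm]
    exact h j i h'

lemma comp_mem_Dset {d m n : ℕ} {ε : ℝ} {Z : Fin n → Rd d × Rd d} (hZ : Z ∈ Dset d n ε)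
    {e : Fin m → Fin n} (he : Function.Injective e) : Z ∘ e ∈ Dset d m ε :=
  mem_Dset_iff_ne.2 fun i j hij => mem_Dset_iff_ne.1 hZ (e i) (e j) (he.ne hij)

section Exclusion

variable {d : ℕ} {ε κ : ℝ} {μ : Measure (Rd d × Rd d)} [IsProbabilityMeasure μ]

lemma pi_real_removeNth_preimage {n : ℕ} (j : Fin (n + 1)) (T : Set (Fin n → Rd d × Rd d))
    (hT : MeasurableSet T) :
    (Measure.pi fun _ : Fin (n + 1) => μ).real {W | W ∘ j.succAbove ∈ T} =
      (Measure.pi fun _ : Fin n => μ).real T := by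
  have h := (measurePreserving_piFinSuccAbove (fun _ : Fin (n + 1) => μ) j).measure_preimage
    (s := Set.univ ×ˢ T) (MeasurableSet.univ.prod hT).nullMeasurableSet
  rw [Measure.prod_prod, measure_univ, one_mul] at h
  rw [measureReal_def, measureReal_def, ← h]
  congr 2
  ext W
  simp only [Set.mem_ofPred_eq, Set.mem_preimage, Set.mem_prod, Set.mem_univ, true_and]
  rfl

/-- The probability that one particle lies within `ε` of a point determined by the others. -/
lemma pi_real_near_le (hκ : ∀ x, μ.real {z | dist x z.1 ≤ ε} ≤ κ) {n : ℕ} (j : Fin (n + 1))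
    {T : Set (Fin n → Rd d × Rd d)} (hT : MeasurableSet T)
    {g : (Fin n → Rd d × Rd d) → Rd d} (hg : Measurable g) :
    (Measure.pi fun _ : Fin (n + 1) => μ).real
        {W | W ∘ j.succAbove ∈ T ∧ dist (g (W ∘ j.succAbove)) (W j).1 ≤ ε} ≤
      κ * (Measure.pi fun _ : Fin n => μ).real T := by
  have hκ0 : 0 ≤ κ := measureReal_nonneg.trans (hκ 0)
  set S : Set ((Rd d × Rd d) × (Fin n → Rd d × Rd d)) :=
    {p | p.2 ∈ T ∧ dist (g p.2) p.1.1 ≤ ε} with hSdef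
  have hS : MeasurableSet S :=
    (measurable_snd hT).inter
      (measurableSet_le (f := fun p : (Rd d × Rd d) × (Fin n → Rd d × Rd d) =>
        dist (g p.2) p.1.1) (by fun_prop) measurable_const)
  have h := (measurePreserving_piFinSuccAbove (fun _ : Fin (n + 1) => μ) j).measure_preimage
    (s := S) hS.nullMeasurableSet
  have hle : (μ.prod (Measure.pi fun _ : Fin n => μ)) S ≤
      ENNReal.ofReal κ * (Measure.pi fun _ : Fin n => μ) T := by
    rw [Measure.prod_apply_symm hS, ← lintegral_indicator_const hT]
    refine lintegral_mono fun W => ?_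
    by_cases hW : W ∈ T
    · rw [Set.indicator_of_mem hW]
      have : (fun x => (x, W)) ⁻¹' S = {z | dist (g W) z.1 ≤ ε} := by
        ext z; simp [hSdef, hW]
      rw [this, ← ofReal_measureReal]
      exact ENNReal.ofReal_le_ofReal (hκ _)
    · have : (fun x => (x, W)) ⁻¹' S = ∅ := by
        ext z; simp [hSdef, hW]
      rw [this]
      simp
  refine ENNReal.toReal_le_of_le_ofReal (mul_nonneg hκ0 measureReal_nonneg) ?_
  rw [ENNReal.ofReal_mul hκ0, ofReal_measureReal]
  exact le_trans h.le hle

/-- Removing a particle increases the partition function. -/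
lemma pi_real_Dset_antitone :
    Antitone fun n => (Measure.pi fun _ : Fin n => μ).real (Dset d n ε) := by
  refine antitone_nat_of_succ_le fun n => ?_
  rw [← pi_real_removeNth_preimage 0 _ (measurableSet_Dset d n ε)]
  exact measureReal_mono fun W hW => comp_mem_Dset hW (Fin.succAbove_right_injective)

lemma one_sub_mul_pi_real_Dset_le (hκ : ∀ x, μ.real {z | dist x z.1 ≤ ε} ≤ κ) (n : ℕ) :
    (1 - n * κ) * (Measure.pi fun _ : Fin n => μ).real (Dset d n ε) ≤
      (Measure.pi fun _ : Fin (n + 1) => μ).real (Dset d (n + 1) ε) := by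
  set P := Measure.pi fun _ : Fin (n + 1) => μ
  set B : Fin n → Set (Fin (n + 1) → Rd d × Rd d) := fun i =>
    {W | W ∘ Fin.succAbove 0 ∈ Dset d n ε ∧
      dist ((W ∘ Fin.succAbove 0) i).1 (W 0).1 ≤ ε}
  have hsub : {W | W ∘ Fin.succAbove 0 ∈ Dset d n ε} ⊆ Dset d (n + 1) ε ∪ ⋃ i, B i := by
    intro W hW
    by_cases h : ∃ i, W ∈ B i
    · exact Or.inr (Set.mem_iUnion.2 h)
    · refine Or.inl fun i j hij => ?_
      have hj : j ≠ 0 := (Fin.zero_le i |>.trans_lt hij).ne'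
      obtain ⟨j, rfl⟩ := Fin.exists_succ_eq.2 hj
      rcases Fin.eq_zero_or_eq_succ i with rfl | ⟨i, rfl⟩
      · by_contra hcon
        exact h ⟨j, hW, by rw [dist_comm]; exact not_lt.1 hcon⟩
      · exact hW i j (Fin.succ_lt_succ_iff.1 hij)
  have h1 := measureReal_mono (μ := P) hsub
  rw [pi_real_removeNth_preimage 0 _ (measurableSet_Dset d n ε)] at h1
  have h2 := measureReal_union_le (μ := P) (Dset d (n + 1) ε) (⋃ i, B i)
  have h3 := measureReal_iUnion_fintype_le (μ := P) B
  have h4 : ∑ i, P.real (B i) ≤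
      ∑ _i : Fin n, κ * (Measure.pi fun _ : Fin n => μ).real (Dset d n ε) :=
    Finset.sum_le_sum fun i _ => pi_real_near_le hκ 0 (measurableSet_Dset d n ε)
      (g := fun V => (V i).1) (by fun_prop)
  simp only [Finset.sum_const, Finset.card_univ, Fintype.card_fin, nsmul_eq_mul] at h4
  linarith

lemma pi_real_Dset_pos (hκ : ∀ x, μ.real {z | dist x z.1 ≤ ε} ≤ κ) {n : ℕ} (hn : n * κ < 1) :
    0 < (Measure.pi fun _ : Fin n => μ).real (Dset d n ε) := by
  have hκ0 : 0 ≤ κ := measureReal_nonneg.trans (hκ 0)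
  induction n with
  | zero =>
    have : Dset d 0 ε = Set.univ := Set.eq_univ_of_forall fun _ i => i.elim0
    simp [this]
  | succ n ih =>
    push_cast at hn
    exact (mul_pos (by linarith) (ih (by linarith))).trans_le
      (one_sub_mul_pi_real_Dset_le hκ n)

/-- Union bound for `n + 1` new particles that must avoid `s` given points. -/
lemma pi_real_avoid_ge (hκ : ∀ x, μ.real {z | dist x z.1 ≤ ε} ≤ κ) {s n : ℕ}
    (X : Fin s → Rd d) :
    (Measure.pi fun _ : Fin (n + 1) => μ).real (Dset d (n + 1) ε) -
        s * (n + 1) * κ * (Measure.pi fun _ : Fin n => μ).real (Dset d n ε) ≤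
      (Measure.pi fun _ : Fin (n + 1) => μ).real
        {W | W ∈ Dset d (n + 1) ε ∧ ∀ i j, ε < dist (X i) (W j).1} := by
  set P := Measure.pi fun _ : Fin (n + 1) => μ
  set A : Set (Fin (n + 1) → Rd d × Rd d) :=
    {W | W ∈ Dset d (n + 1) ε ∧ ∀ i j, ε < dist (X i) (W j).1}
  set B : Fin s × Fin (n + 1) → Set (Fin (n + 1) → Rd d × Rd d) := fun p =>
    {W | W ∘ p.2.succAbove ∈ Dset d n ε ∧ dist (X p.1) (W p.2).1 ≤ ε}
  have hsub : Dset d (n + 1) ε ⊆ A ∪ ⋃ p, B p := by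
    intro W hW
    by_cases h : ∃ p, W ∈ B p
    · exact Or.inr (Set.mem_iUnion.2 h)
    · refine Or.inl ⟨hW, fun i j => ?_⟩
      by_contra hcon
      exact h ⟨(i, j), comp_mem_Dset hW Fin.succAbove_right_injective, not_lt.1 hcon⟩
  have h1 := measureReal_mono (μ := P) hsub
  have h2 := measureReal_union_le (μ := P) A (⋃ p, B p)
  have h3 := measureReal_iUnion_fintype_le (μ := P) B
  have h4 : ∑ p, P.real (B p) ≤
      ∑ _p : Fin s × Fin (n + 1), κ * (Measure.pi fun _ : Fin n => μ).real (Dset d n ε) :=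
    Finset.sum_le_sum fun p _ => pi_real_near_le hκ p.2 (measurableSet_Dset d n ε)
      (g := fun _ => X p.1) (by fun_prop)
  simp only [Finset.sum_const, Finset.card_univ, Fintype.card_prod, Fintype.card_fin,
    nsmul_eq_mul] at h4
  push_cast at h4
  linarith

/-- The probability that `n` new particles avoid `s` given points, relative to the partition
function of `s + n` particles. -/
lemma one_sub_mul_pi_real_Dset_le_avoid (hκ : ∀ x, μ.real {z | dist x z.1 ≤ ε} ≤ κ) {s n : ℕ}
    (X : Fin s → Rd d) :
    (1 - (s + 1) * ((s + n : ℕ) * κ)) *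
        (Measure.pi fun _ : Fin (s + n) => μ).real (Dset d (s + n) ε) ≤
      (Measure.pi fun _ : Fin n => μ).real
        {W | W ∈ Dset d n ε ∧ ∀ i j, ε < dist (X i) (W j).1} := by
  have hκ0 : 0 ≤ κ := measureReal_nonneg.trans (hκ 0)
  rcases le_total (1 - (s + 1) * ((s + n : ℕ) * κ)) 0 with hneg | hpos
  · exact (mul_nonpos_of_nonpos_of_nonneg hneg measureReal_nonneg).trans measureReal_nonneg
  rcases n with _ | n
  · have huniv : {W | W ∈ Dset d 0 ε ∧ ∀ (i : Fin s) (j : Fin 0), ε < dist (X i) (W j).1} =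
        Set.univ := Set.eq_univ_of_forall fun _ => ⟨fun i => i.elim0, fun _ j => j.elim0⟩
    rw [huniv, probReal_univ]
    refine mul_le_one₀ ?_ measureReal_nonneg measureReal_le_one
    have : 0 ≤ ((s : ℝ) + 1) * ((s + 0 : ℕ) * κ) := by positivity
    linarith
  · refine le_trans ?_ (pi_real_avoid_ge hκ X)
    have hanti := pi_real_Dset_antitone (d := d) (ε := ε) (μ := μ) (by omega : n + 1 ≤ s + (n + 1))
    have hstep := one_sub_mul_pi_real_Dset_le (d := d) (ε := ε) (μ := μ) hκ n
    simp only at hanti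
    set p := (Measure.pi fun _ : Fin n => μ).real (Dset d n ε)
    set q := (Measure.pi fun _ : Fin (n + 1) => μ).real (Dset d (n + 1) ε)
    have hp : 0 ≤ p := measureReal_nonneg
    refine (mul_le_mul_of_nonneg_left hanti hpos).trans ?_
    push_cast at hpos ⊢
    set σ : ℝ := (s : ℝ)
    set m : ℝ := (n : ℝ)
    have hσ0 : 0 ≤ σ := Nat.cast_nonneg s
    have hm : 0 ≤ m := Nat.cast_nonneg n
    -- the total number of particles is `σ + m + 1`, and `(σ + 1) (σ + m + 1) κ ≤ 1`
    have hσ : σ ≤ (σ + 1) * (1 - m * κ) := by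
      nlinarith [mul_nonneg (by positivity : 0 ≤ (σ + 1) * (σ + 1)) hκ0]
    have hmain : σ * (m + 1) * κ * p ≤ (σ + 1) * ((σ + (m + 1)) * κ) * q := by
      calc σ * (m + 1) * κ * p ≤ ((σ + 1) * (1 - m * κ)) * (m + 1) * κ * p := by gcongr
        _ = (σ + 1) * ((m + 1) * κ) * ((1 - m * κ) * p) := by ring
        _ ≤ (σ + 1) * ((m + 1) * κ) * q := by gcongr
        _ ≤ (σ + 1) * ((σ + (m + 1)) * κ) * q := by
          have hq : 0 ≤ q := measureReal_nonneg
          exact mul_le_mul_of_nonneg_right (mul_le_mul_of_nonneg_left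
            (mul_le_mul_of_nonneg_right (by linarith) hκ0) (by linarith)) hq
    linarith

end Exclusion

/-- A density with bounded spatial marginal gives balls of radius `ε` mass at most
`|B_1| M ε ^ d`. -/
lemma withDensity_real_near_le {d : ℕ} {ε M : ℝ} (hε : 0 < ε) {f₀ : Rd d × Rd d → ℝ}
    (hnn : ∀ z, 0 ≤ f₀ z) (hint : Integrable f₀)
    (hM : ∀ᵐ x : Rd d, (∫ v : Rd d, f₀ (x, v)) ≤ M) (x : Rd d) :
    (volume.withDensity fun z => ENNReal.ofReal (f₀ z)).real {z | dist x z.1 ≤ ε} ≤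
      unitBallVol d * M * ε ^ d := by
  have hset : {z : Rd d × Rd d | dist x z.1 ≤ ε} = Metric.closedBall x ε ×ˢ Set.univ := by
    ext z
    simp [dist_comm]
  have hmeas : MeasurableSet {z : Rd d × Rd d | dist x z.1 ≤ ε} :=
    hset ▸ measurableSet_closedBall.prod MeasurableSet.univ
  have hvol : volume.real (Metric.closedBall x ε) = ε ^ d * unitBallVol d := by
    rw [measureReal_def, Measure.addHaar_closedBall volume x hε.le, ENNReal.toReal_mul,
      ENNReal.toReal_ofReal (by positivity), unitBallVol]
    simp
  rw [measureReal_def, withDensity_apply _ hmeas, ← ofReal_integral_eq_lintegral_ofReal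
    hint.restrict (Filter.Eventually.of_forall hnn),
    ENNReal.toReal_ofReal (integral_nonneg hnn), hset, Measure.volume_eq_prod,
    setIntegral_prod _ (hint.integrableOn)]
  simp only [Measure.restrict_univ]
  have hint' : Integrable fun y : Rd d => ∫ v : Rd d, f₀ (y, v) := hint.integral_prod_left
  calc ∫ y in Metric.closedBall x ε, ∫ v, f₀ (y, v)
      ≤ ∫ _y in Metric.closedBall x ε, M :=
        integral_mono_ae hint'.restrict
          (integrableOn_const measure_closedBall_lt_top.ne) (ae_restrict_of_ae hM)
    _ = unitBallVol d * M * ε ^ d := by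
        rw [setIntegral_const, hvol, smul_eq_mul]
        ring

lemma append_comp_cast_mem_Dset {d s n N : ℕ} {ε : ℝ} (h : N = s + n)
    (Z : Fin s → Rd d × Rd d) (W : Fin n → Rd d × Rd d) :
    Fin.append Z W ∘ Fin.cast h ∈ Dset d N ε ↔
      Z ∈ Dset d s ε ∧ W ∈ Dset d n ε ∧ ∀ i j, ε < dist (Z i).1 (W j).1 := by
  subst h
  rw [Fin.cast_refl, Function.comp_id]
  have hlt (i : Fin s) (j : Fin n) : Fin.castAdd n i < Fin.natAdd s j := by
    simp only [Fin.lt_def, Fin.val_castAdd, Fin.val_natAdd]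
    omega
  constructor
  · intro hZW
    refine ⟨?_, ?_, fun i j => ?_⟩
    · simpa [Function.comp_def] using comp_mem_Dset hZW (Fin.castAdd_injective s n)
    · simpa [Function.comp_def] using comp_mem_Dset hZW (Fin.natAdd_injective n s)
    · simpa using hZW (Fin.castAdd n i) (Fin.natAdd s j) (hlt i j)
  · rintro ⟨hZ, hW, hcross⟩ i j hij
    induction i using Fin.addCases with
    | left i =>
      induction j using Fin.addCases with
      | left j => simpa using hZ i j hij
      | right j => simpa using hcross i j
    | right i =>
      induction j using Fin.addCases with
      | left j => exact absurd hij (hlt j i).not_gt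
      | right j => simpa using hW i j ((Fin.natAdd_lt_natAdd_iff s).1 hij)

lemma prod_append_comp_cast {α : Type*} {s n N : ℕ} (h : N = s + n) (f : α → ℝ)
    (Z : Fin s → α) (W : Fin n → α) :
    ∏ i, f ((Fin.append Z W ∘ Fin.cast h) i) = (∏ i, f (Z i)) * ∏ j, f (W j) := by
  subst h
  simp [Fin.prod_univ_add]

lemma marginal_conditionedData {d N s : ℕ} {ε : ℝ} (hsN : s ≤ N) {f₀ : Rd d × Rd d → ℝ}
    (hnn : ∀ z, 0 ≤ f₀ z) (hint : Integrable f₀) (Z : Fin s → Rd d × Rd d) :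
    marginal d N s hsN (conditionedData d N ε f₀) Z =
      (partitionFunction d N ε f₀)⁻¹ *
        (Set.indicator (Dset d s ε) (fun W => ∏ i, f₀ (W i)) Z *
          (Measure.pi fun _ : Fin (N - s) =>
            volume.withDensity fun z => ENNReal.ofReal (f₀ z)).real
            {W | W ∈ Dset d (N - s) ε ∧ ∀ i j, ε < dist (Z i).1 (W j).1}) := by
  set A : Set (Fin (N - s) → Rd d × Rd d) :=
    {W | W ∈ Dset d (N - s) ε ∧ ∀ i j, ε < dist (Z i).1 (W j).1}
  have hA : MeasurableSet A := by
    have hcross : MeasurableSet {W : Fin (N - s) → Rd d × Rd d |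
        ∀ i j, ε < dist (Z i).1 (W j).1} := by
      simp only [Set.ofPred_forall]
      exact MeasurableSet.iInter fun i => MeasurableSet.iInter fun j =>
        measurableSet_lt (by fun_prop) (by fun_prop)
    exact (measurableSet_Dset d (N - s) ε).inter hcross
  rw [← setIntegral_prod_eq_pi_withDensity hnn hint hA, ← integral_indicator hA,
    ← integral_const_mul, ← integral_const_mul]
  refine integral_congr_ae (Filter.Eventually.of_forall fun W => ?_)
  have hmem := append_comp_cast_mem_Dset (ε := ε) (Nat.add_sub_cancel' hsN).symm Z W
  simp only [conditionedData]
  congr 1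
  by_cases hZ : Z ∈ Dset d s ε
  · by_cases hW : W ∈ A
    · rw [Set.indicator_of_mem (hmem.2 ⟨hZ, hW⟩), Set.indicator_of_mem hZ,
        Set.indicator_of_mem hW, prod_append_comp_cast]
    · rw [Set.indicator_of_notMem fun h => hW (hmem.1 h).2, Set.indicator_of_notMem hW, mul_zero]
  · rw [Set.indicator_of_notMem fun h => hZ (hmem.1 h).1, Set.indicator_of_notMem hZ, zero_mul]

/-- **Lower bound on the marginals of the conditioned tensorized data (Lemma 12.4).**
In the Boltzmann–Grad scaling, if `ℓ⁻¹ |B_1^d| M ε < 1` then for every `1 ≤ s ≤ N`,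
almost every `Z_s`:
`f_N^{(s)}(0,Z_s) ≥ 1_{Z_s ∈ D_s} ∏ f₀(z_i) (1 − (s+1) ℓ⁻¹ |B_1^d| M ε)`. -/
theorem conditioned_data_marginal_lower_bound
    (d N : ℕ) (hd : 2 ≤ d) (ℓ ε M : ℝ) (hℓ : 0 < ℓ) (hε : 0 < ε)
    (hscale : (N : ℝ) * ε ^ (d - 1) = ℓ⁻¹)
    (f₀ : Rd d × Rd d → ℝ) (hmeas : Measurable f₀) (hnn : ∀ z, 0 ≤ f₀ z)
    (hint : Integrable f₀) (hmass : ∫ z, f₀ z = 1)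
    (hM : ∀ᵐ x : Rd d, (∫ v : Rd d, f₀ (x, v)) ≤ M)
    (hsmall : ℓ⁻¹ * unitBallVol d * M * ε < 1)
    (s : ℕ) (hs : 1 ≤ s) (hsN : s ≤ N) :
    ∀ᵐ Z : Fin s → Rd d × Rd d,
      Set.indicator (Dset d s ε) (fun W => ∏ i, f₀ (W i)) Z *
          (1 - ((s : ℝ) + 1) * ℓ⁻¹ * unitBallVol d * M * ε)
        ≤ marginal d N s hsN (conditionedData d N ε f₀) Z := by
  set μ : Measure (Rd d × Rd d) := volume.withDensity fun z => ENNReal.ofReal (f₀ z) with hμ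
  have : IsProbabilityMeasure μ := ⟨by
    rw [hμ, withDensity_apply _ MeasurableSet.univ, Measure.restrict_univ,
      ← ofReal_integral_eq_lintegral_ofReal hint (Filter.Eventually.of_forall hnn), hmass,
      ENNReal.ofReal_one]⟩
  have hκ : ∀ x, μ.real {z | dist x z.1 ≤ ε} ≤ unitBallVol d * M * ε ^ d :=
    withDensity_real_near_le hε hnn hint hM
  have hNκ : (N : ℝ) * (unitBallVol d * M * ε ^ d) = ℓ⁻¹ * unitBallVol d * M * ε := by
    rw [← hscale, ← pow_sub_one_mul (by omega : d ≠ 0) ε]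
    ring
  have hpart : partitionFunction d N ε f₀ = (Measure.pi fun _ : Fin N => μ).real (Dset d N ε) :=
    setIntegral_prod_eq_pi_withDensity hnn hint (measurableSet_Dset d N ε)
  refine Filter.Eventually.of_forall fun Z => ?_
  rw [marginal_conditionedData hsN hnn hint, hpart, mul_left_comm]
  refine mul_le_mul_of_nonneg_left ?_
    (Set.indicator_nonneg (fun W _ => Finset.prod_nonneg fun i _ => hnn _) Z)
  rw [← div_eq_inv_mul, le_div_iff₀ (pi_real_Dset_pos hκ (hNκ.trans_lt hsmall))]
  have hN : s + (N - s) = N := Nat.add_sub_cancel' hsN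
  have key := one_sub_mul_pi_real_Dset_le_avoid hκ (n := N - s) fun i => (Z i).1
  rw [hN, hNκ] at key
  simpa only [mul_assoc] using key
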